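/- arXiv:2405.06339 — 6 statements merged into one kernel-verified Lean document; each statement's English description precedes it below -/
import Mathlib

section
/- Let X_S and X_M be independent random variables with CDFs F_S(x) = 1 - exp(-2λ_S x) and F_M(x) = 1 - exp(-λ_M π x²) for x ≥ 0, where λ_S, λ_M > 0, and let α > 0 and B > 0. When α_S = α_M = α, the probability of Case 1 has the closed form ℙ(X_M < B^{1/α} X_S) = 1 - sqrt(λ_S²/(λ_M B^{2/α})) · exp(λ_S²/(λ_M π B^{2/α})) · erfc(λ_S/sqrt(λ_M π B^{2/α})). -/
open MeasureTheory ProbabilityTheory Real Set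

/-- The complementary error function `erfc z = (2/√π) ∫_z^∞ exp(-t²) dt`. -/
noncomputable def erfc (z : ℝ) : ℝ :=
  (2 / Real.sqrt π) * ∫ t in Set.Ioi z, Real.exp (-t ^ 2)

theorem integral_comp_mul_add_Ioi (g : ℝ → ℝ) (a d : ℝ) {b : ℝ} (hb : 0 < b) :
    ∫ x in Ioi a, g (b * x + d) = b⁻¹ * ∫ x in Ioi (b * a + d), g x := by
  have h := (measurePreserving_add_right volume d).setIntegral_preimage_emb
    (measurableEmbedding_addRight d) g (Ioi (b * a + d))
  rw [integral_comp_mul_left_Ioi (fun x => g (x + d)) a hb, smul_eq_mul, ← h]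
  simp

/-- The one-sided Laplace transform of a Gaussian, obtained by completing the square. -/
theorem integral_exp_neg_mul_sub_sq_Ioi (r : ℝ) {k : ℝ} (hk : 0 < k) :
    ∫ x in Ioi (0 : ℝ), exp (-(r * x)) * exp (-(k * x ^ 2))
      = √π / (2 * √k) * exp (r ^ 2 / (4 * k)) * erfc (r / (2 * √k)) := by
  have hs : 0 < √k := sqrt_pos.2 hk
  have hp : 0 < √π := sqrt_pos.2 pi_pos
  have hsq : √k ^ 2 = k := sq_sqrt hk.le
  have hpt (x : ℝ) : exp (-(r * x)) * exp (-(k * x ^ 2))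
      = exp (r ^ 2 / (4 * k)) * exp (-(√k * x + r / (2 * √k)) ^ 2) := by
    rw [← exp_add, ← exp_add]
    congr 1
    conv_lhs => rw [← hsq]
    conv_rhs => rw [← hsq, sqrt_sq hs.le]
    field_simp
    ring
  simp_rw [hpt]
  rw [integral_const_mul,
    integral_comp_mul_add_Ioi (fun t => exp (-t ^ 2)) 0 (r / (2 * √k)) hs, erfc,
    mul_zero, zero_add]
  field_simp

theorem integral_exponential_mul_one_sub_gaussian {r k : ℝ} (hr : 0 < r) (hk : 0 < k) :
    IntegrableOn (fun x => r * exp (-(r * x)) * (1 - exp (-(k * x ^ 2)))) (Ioi 0) ∧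
    ∫ x in Ioi (0 : ℝ), r * exp (-(r * x)) * (1 - exp (-(k * x ^ 2)))
      = 1 - r * (√π / (2 * √k) * exp (r ^ 2 / (4 * k)) * erfc (r / (2 * √k))) := by
  have h1 : IntegrableOn (fun x => exp (-(r * x))) (Ioi 0) := by
    simpa only [neg_mul] using exp_neg_integrableOn_Ioi 0 hr
  have h2 : IntegrableOn (fun x => exp (-(r * x)) * exp (-(k * x ^ 2))) (Ioi 0) := by
    refine Integrable.mono' h1 (by fun_prop) (ae_of_all _ fun x => ?_)
    rw [norm_of_nonneg (by positivity)]
    exact mul_le_of_le_one_right (exp_pos _).le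
      (exp_le_one_iff.2 (neg_nonpos.2 (by positivity)))
  have hpt (x : ℝ) : r * exp (-(r * x)) * (1 - exp (-(k * x ^ 2)))
      = r * exp (-(r * x)) - r * (exp (-(r * x)) * exp (-(k * x ^ 2))) := by ring
  have h3 : ∫ x in Ioi (0 : ℝ), exp (-(r * x)) = r⁻¹ := by
    have := integral_exp_mul_Ioi (neg_neg_of_pos hr) 0
    simpa [neg_mul, neg_div] using this
  simp_rw [hpt]
  refine ⟨(h1.const_mul r).sub (h2.const_mul r), ?_⟩
  rw [integral_sub (h1.const_mul r) (h2.const_mul r), integral_const_mul, integral_const_mul,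
    h3, integral_exp_neg_mul_sub_sq_Ioi r hk, mul_inv_cancel₀ hr.ne']

/-- A probability measure on `ℝ` with continuous distribution function `F` gives mass `F x`
to the open half-line below `x`. -/
theorem measure_Iio_of_continuous_cdf (ν : Measure ℝ) [IsProbabilityMeasure ν] {F : ℝ → ℝ}
    (hF : Continuous F) (h : ∀ x, cdf ν x = F x) (x : ℝ) :
    ν (Iio x) = ENNReal.ofReal (F x) := by
  have hF' : ⇑(cdf ν) = F := funext h
  conv_lhs => rw [← measure_cdf ν]
  rw [StieltjesFunction.measure_Iio _ (tendsto_cdf_atBot ν), sub_zero, hF',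
    hF.continuousAt.continuousWithinAt.leftLim_eq]

theorem map_eq_expMeasure {Ω : Type*} [MeasurableSpace Ω] {μ : Measure Ω}
    [IsProbabilityMeasure μ] {X : Ω → ℝ} (hX : Measurable X) {r : ℝ} (hr : 0 < r)
    (hF : ∀ x : ℝ, 0 ≤ x → μ {ω | X ω ≤ x} = ENNReal.ofReal (1 - exp (-(r * x))))
    (hFneg : ∀ x : ℝ, x < 0 → μ {ω | X ω ≤ x} = 0) :
    μ.map X = expMeasure r := by
  have := isProbabilityMeasure_expMeasure hr
  have := Measure.isProbabilityMeasure_map (μ := μ) hX.aemeasurable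
  refine Measure.ext_of_Iic _ _ fun x => ?_
  rw [← ofReal_cdf (expMeasure r), cdf_expMeasure_eq hr, Measure.map_apply hX measurableSet_Iic]
  split_ifs with hx
  · exact hF x hx
  · rw [ENNReal.ofReal_zero]
    exact hFneg x (not_le.1 hx)

theorem map_Iio_of_rayleigh_cdf {Ω : Type*} [MeasurableSpace Ω] {μ : Measure Ω}
    [IsProbabilityMeasure μ] {X : Ω → ℝ} (hX : Measurable X) {k : ℝ} (hk : 0 < k)
    (hF : ∀ x : ℝ, 0 ≤ x → μ {ω | X ω ≤ x} = ENNReal.ofReal (1 - exp (-(k * x ^ 2))))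
    (hFneg : ∀ x : ℝ, x < 0 → μ {ω | X ω ≤ x} = 0) (x : ℝ) :
    μ.map X (Iio x) = ENNReal.ofReal (1 - exp (-(k * max x 0 ^ 2))) := by
  have := Measure.isProbabilityMeasure_map (μ := μ) hX.aemeasurable
  refine measure_Iio_of_continuous_cdf _ (F := fun x => 1 - exp (-(k * max x 0 ^ 2)))
    (by fun_prop) (fun x => ?_) x
  have hnn : 0 ≤ 1 - exp (-(k * max x 0 ^ 2)) :=
    sub_nonneg.2 (exp_le_one_iff.2 (neg_nonpos.2 (by positivity)))
  rw [cdf_eq_real, measureReal_def, Measure.map_apply hX measurableSet_Iic,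
    ← ENNReal.toReal_ofReal hnn]
  congr 1
  rcases le_or_gt 0 x with hx | hx
  · rw [max_eq_left hx]
    exact hF x hx
  · rw [max_eq_right hx.le]
    simpa using! hFneg x hx

theorem case1_association_probability_closed_form
    {Ω : Type*} [MeasurableSpace Ω] (μ : Measure Ω) [IsProbabilityMeasure μ]
    (XS XM : Ω → ℝ) (hXSm : Measurable XS) (hXMm : Measurable XM)
    (hindep : IndepFun XS XM μ)
    (lamS lamM α B : ℝ)
    (hlamS : 0 < lamS) (hlamM : 0 < lamM)
    (hα : 0 < α) (hB : 0 < B)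
    (hFS : ∀ x : ℝ, 0 ≤ x →
      μ {ω | XS ω ≤ x} = ENNReal.ofReal (1 - Real.exp (-(2 * lamS * x))))
    (hFSneg : ∀ x : ℝ, x < 0 → μ {ω | XS ω ≤ x} = 0)
    (hFM : ∀ x : ℝ, 0 ≤ x →
      μ {ω | XM ω ≤ x} = ENNReal.ofReal (1 - Real.exp (-(lamM * π * x ^ 2))))
    (hFMneg : ∀ x : ℝ, x < 0 → μ {ω | XM ω ≤ x} = 0) :
    μ {ω | XM ω < B ^ (1 / α) * XS ω}
      = ENNReal.ofReal (1 - Real.sqrt (lamS ^ 2 / (lamM * B ^ (2 / α)))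
          * Real.exp (lamS ^ 2 / (lamM * π * B ^ (2 / α)))
          * erfc (lamS / Real.sqrt (lamM * π * B ^ (2 / α)))) := by
  have := Measure.isProbabilityMeasure_map (μ := μ) hXMm.aemeasurable
  set c : ℝ := B ^ (1 / α) with hc
  have hc0 : 0 < c := rpow_pos_of_pos hB _
  have hc2 : B ^ (2 / α) = c ^ 2 := by
    rw [hc, ← rpow_natCast, ← rpow_mul hB.le]
    congr 1
    push_cast
    ring
  have hr : 0 < 2 * lamS := by positivity
  have hkM : 0 < lamM * π := by positivity
  have hk : 0 < lamM * π * c ^ 2 := by positivity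
  have hset : MeasurableSet {p : ℝ × ℝ | p.2 < c * p.1} :=
    measurableSet_lt measurable_snd (measurable_fst.const_mul c)
  have hjoint : μ {ω | XM ω < c * XS ω}
      = ∫⁻ x, μ.map XM (Iio (c * x)) ∂expMeasure (2 * lamS) := by
    rw [← map_eq_expMeasure hXSm hr hFS hFSneg]
    have := Measure.isProbabilityMeasure_map (μ := μ) hXSm.aemeasurable
    have h := Measure.prod_apply (μ := μ.map XS) (ν := μ.map XM) hset
    rw [← hindep.map_prod_eq_prod_map_map hXSm.aemeasurable hXMm.aemeasurable,
      Measure.map_apply (hXSm.prodMk hXMm) hset] at h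
    exact h
  obtain ⟨hint, hval⟩ := integral_exponential_mul_one_sub_gaussian hr hk
  have hpt (x : ℝ) : (exponentialPDF (2 * lamS) *
        fun x => ENNReal.ofReal (1 - exp (-(lamM * π * max (c * x) 0 ^ 2)))) x
      = (Ioi (0 : ℝ)).indicator (fun x => ENNReal.ofReal (2 * lamS * exp (-(2 * lamS * x)) *
          (1 - exp (-(lamM * π * c ^ 2 * x ^ 2))))) x := by
    rcases lt_or_ge 0 x with hx | hx
    · rw [indicator_of_mem (mem_Ioi.2 hx), Pi.mul_apply, exponentialPDF_of_nonneg hx.le,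
        max_eq_left (by positivity), ← ENNReal.ofReal_mul (by positivity), mul_pow,
        mul_assoc _ (c ^ 2)]
    · rw [indicator_of_notMem (notMem_Ioi.2 hx), Pi.mul_apply,
        max_eq_right (mul_nonpos_of_nonneg_of_nonpos hc0.le hx)]
      simp
  rw [hjoint]
  simp_rw [map_Iio_of_rayleigh_cdf hXMm hkM hFM hFMneg]
  have hnn : 0 ≤ᵐ[volume.restrict (Ioi (0 : ℝ))] fun x => 2 * lamS * exp (-(2 * lamS * x)) *
      (1 - exp (-(lamM * π * c ^ 2 * x ^ 2))) :=
    ae_of_all _ fun x => mul_nonneg (by positivity)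
      (sub_nonneg.2 (exp_le_one_iff.2 (neg_nonpos.2 (by positivity))))
  have hdens : expMeasure (2 * lamS) = volume.withDensity (exponentialPDF (2 * lamS)) := rfl
  have hmeas : Measurable (exponentialPDF (2 * lamS)) :=
    (measurable_exponentialPDFReal _).ennreal_ofReal
  rw [hdens, lintegral_withDensity_eq_lintegral_mul _ hmeas (by fun_prop), lintegral_congr hpt,
    lintegral_indicator measurableSet_Ioi, ← ofReal_integral_eq_lintegral_ofReal hint hnn, hval,
    hc2]
  have h1 : √(lamM * π * c ^ 2) = √lamM * √π * c := by
    rw [sqrt_mul hkM.le, sqrt_mul hlamM.le, sqrt_sq hc0.le]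
  have h2 : √(lamS ^ 2 / (lamM * c ^ 2)) = lamS / (√lamM * c) := by
    rw [sqrt_div (sq_nonneg _), sqrt_mul hlamM.le, sqrt_sq hlamS.le, sqrt_sq hc0.le]
  have h3 : (2 * lamS) ^ 2 / (4 * (lamM * π * c ^ 2)) = lamS ^ 2 / (lamM * π * c ^ 2) := by
    field_simp
    ring
  have h4 : 2 * lamS / (2 * (√lamM * √π * c)) = lamS / (√lamM * √π * c) :=
    mul_div_mul_left _ _ two_ne_zero
  have hsM : 0 < √lamM := sqrt_pos.2 hlamM
  have hsp : 0 < √π := sqrt_pos.2 pi_pos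
  rw [h1, h2, h3, h4]
  congr 2
  field_simp
end

section
/- Let X_S and X_M be independent random variables with CDFs F_S(x) = 1 - exp(-2λ_S x) and F_M(x) = 1 - exp(-λ_M π x²) for x ≥ 0, where λ_S, λ_M > 0, let α_S, α_M > 0, and let 0 < B < A. Then the probability of Case 2, ℙ(B·X_M^{-α_M} < X_S^{-α_S} < A·X_M^{-α_M}), equals ∫_0^∞ 2λ_S exp(-λ_M π B^{2/α_M} x^{2α_S/α_M} - 2λ_S x) dx - ∫_0^∞ 2λ_S exp(-λ_M π A^{2/α_M} x^{2α_S/α_M} - 2λ_S x) dx. -/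
open MeasureTheory ProbabilityTheory Real Set

/-- A probability measure on `ℝ` whose distribution function is `1 - exp (-(r * x))` on `[0, ∞)`
is the exponential distribution of rate `r`. -/
lemma eq_expMeasure_of_measure_Iic {ν : Measure ℝ} [IsProbabilityMeasure ν] {r : ℝ} (hr : 0 < r)
    (hpos : ∀ x : ℝ, 0 ≤ x → ν (Iic x) = ENNReal.ofReal (1 - Real.exp (-(r * x))))
    (hneg : ∀ x : ℝ, x < 0 → ν (Iic x) = 0) : ν = expMeasure r := by
  have := isProbabilityMeasure_expMeasure hr
  refine Measure.ext_of_Iic ν _ fun x ↦ ?_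
  rw [← ofReal_cdf (expMeasure r), cdf_expMeasure_eq hr]
  split_ifs with hx
  · exact hpos x hx
  · simpa using hneg x (not_le.mp hx)

/-- The mass of an open interval for a measure whose distribution function is
`1 - exp (-(c * x ^ 2))` on `[0, ∞)`. -/
lemma measure_Ioo_of_measure_Iic_eq_exp_sq {ν : Measure ℝ} [IsProbabilityMeasure ν] {c : ℝ}
    (hc : 0 < c)
    (hpos : ∀ x : ℝ, 0 ≤ x → ν (Iic x) = ENNReal.ofReal (1 - Real.exp (-(c * x ^ 2))))
    {a b : ℝ} (ha : 0 ≤ a) (hb : 0 < b) :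
    ν (Ioo a b) = ENNReal.ofReal (Real.exp (-(c * a ^ 2)) - Real.exp (-(c * b ^ 2))) := by
  have hcdf : ∀ x : ℝ, 0 ≤ x → cdf ν x = 1 - Real.exp (-(c * x ^ 2)) := by
    intro x hx
    rw [cdf_eq_real, measureReal_def, hpos x hx, ENNReal.toReal_ofReal]
    have : Real.exp (-(c * x ^ 2)) ≤ 1 := Real.exp_le_one_iff.mpr (by
      have := mul_nonneg hc.le (sq_nonneg x); linarith)
    linarith
  have hcont : ContinuousAt (cdf ν) b := by
    have h : ContinuousAt (fun x : ℝ ↦ 1 - Real.exp (-(c * x ^ 2))) b := by fun_prop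
    refine h.congr ?_
    filter_upwards [Ioi_mem_nhds hb] with x hx
    exact (hcdf x (le_of_lt hx)).symm
  conv_lhs => rw [← measure_cdf ν]
  rw [StieltjesFunction.measure_Ioo, hcont.continuousWithinAt.leftLim_eq, hcdf a ha, hcdf b hb.le]
  congr 1
  ring

lemma mul_rpow_neg_lt_rpow_neg_iff {K x y p q : ℝ} (hK : 0 < K) (hx : 0 < x) (hy : 0 < y)
    (hq : 0 < q) :
    K * y ^ (-q) < x ^ (-p) ↔ K ^ (1 / q) * x ^ (p / q) < y := by
  have h : K ^ (1 / q) * x ^ (p / q) = (K * x ^ p) ^ q⁻¹ := by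
    rw [Real.mul_rpow hK.le (by positivity), ← Real.rpow_mul hx.le, one_div, div_eq_mul_inv]
  have hxp : 0 < x ^ p := by positivity
  have hyq : 0 < y ^ q := by positivity
  rw [h, Real.rpow_inv_lt_iff_of_pos (by positivity) hy.le hq, Real.rpow_neg hy.le,
    Real.rpow_neg hx.le, ← div_eq_mul_inv, ← one_div, div_lt_div_iff₀ hyq hxp, one_mul]

lemma rpow_neg_lt_mul_rpow_neg_iff {K x y p q : ℝ} (hK : 0 < K) (hx : 0 < x) (hy : 0 < y)
    (hq : 0 < q) :
    x ^ (-p) < K * y ^ (-q) ↔ y < K ^ (1 / q) * x ^ (p / q) := by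
  have h : K ^ (1 / q) * x ^ (p / q) = (K * x ^ p) ^ q⁻¹ := by
    rw [Real.mul_rpow hK.le (by positivity), ← Real.rpow_mul hx.le, one_div, div_eq_mul_inv]
  have hxp : 0 < x ^ p := by positivity
  have hyq : 0 < y ^ q := by positivity
  rw [h, Real.lt_rpow_inv_iff_of_pos hy.le (by positivity) hq, Real.rpow_neg hy.le,
    Real.rpow_neg hx.le, ← div_eq_mul_inv, ← one_div, div_lt_div_iff₀ hxp hyq, one_mul]

lemma sq_rpow_mul_rpow {K x p q : ℝ} (hK : 0 < K) (hx : 0 < x) :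
    (K ^ (1 / q) * x ^ (p / q)) ^ 2 = K ^ (2 / q) * x ^ (2 * p / q) := by
  rw [mul_pow, ← Real.rpow_mul_natCast hK.le, ← Real.rpow_mul_natCast hx.le]
  congr 2 <;> push_cast <;> ring

lemma integrableOn_exp_neg_rpow_sub {c r s K : ℝ} (hc : 0 ≤ c) (hr : 0 < r) (hK : 0 < K)
    (t : ℝ) :
    IntegrableOn (fun x : ℝ ↦ r * Real.exp (-(c * K ^ t * x ^ s) - r * x)) (Ioi 0) := by
  refine Integrable.mono' ((integrableOn_exp_mul_Ioi (neg_lt_zero.mpr hr) 0).const_mul r)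
    (by fun_prop) ?_
  filter_upwards [ae_restrict_mem measurableSet_Ioi] with x hx
  have hx : 0 < x := hx
  rw [Real.norm_of_nonneg (by positivity)]
  have : 0 ≤ c * K ^ t * x ^ s := by positivity
  gcongr
  linarith

theorem case2_association_probability
    {Ω : Type*} [MeasurableSpace Ω] (μ : Measure Ω) [IsProbabilityMeasure μ]
    (XS XM : Ω → ℝ) (hXSm : Measurable XS) (hXMm : Measurable XM)
    (hindep : IndepFun XS XM μ)
    (lamS lamM αS αM A B : ℝ)
    (hlamS : 0 < lamS) (hlamM : 0 < lamM)
    (hαS : 0 < αS) (hαM : 0 < αM) (hB : 0 < B) (hBA : B < A)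
    (hFS : ∀ x : ℝ, 0 ≤ x →
      μ {ω | XS ω ≤ x} = ENNReal.ofReal (1 - Real.exp (-(2 * lamS * x))))
    (hFSneg : ∀ x : ℝ, x < 0 → μ {ω | XS ω ≤ x} = 0)
    (hFM : ∀ x : ℝ, 0 ≤ x →
      μ {ω | XM ω ≤ x} = ENNReal.ofReal (1 - Real.exp (-(lamM * π * x ^ 2))))
    (hFMneg : ∀ x : ℝ, x < 0 → μ {ω | XM ω ≤ x} = 0) :
    μ {ω | B * XM ω ^ (-αM) < XS ω ^ (-αS) ∧ XS ω ^ (-αS) < A * XM ω ^ (-αM)}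
      = ENNReal.ofReal
          ((∫ x in Set.Ioi (0 : ℝ),
              2 * lamS * Real.exp (-(lamM * π * B ^ (2 / αM) * x ^ (2 * αS / αM)) - 2 * lamS * x))
           - ∫ x in Set.Ioi (0 : ℝ),
              2 * lamS * Real.exp (-(lamM * π * A ^ (2 / αM) * x ^ (2 * αS / αM)) - 2 * lamS * x)) := by
  have hA : 0 < A := hB.trans hBA
  have hr : 0 < 2 * lamS := by positivity
  have hc : 0 < lamM * π := by positivity
  have := Measure.isProbabilityMeasure_map (μ := μ) hXSm.aemeasurable
  have := Measure.isProbabilityMeasure_map (μ := μ) hXMm.aemeasurable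
  have hS : μ.map XS = expMeasure (2 * lamS) := by
    refine eq_expMeasure_of_measure_Iic hr (fun x hx ↦ ?_) (fun x hx ↦ ?_)
    · rw [Measure.map_apply hXSm measurableSet_Iic]
      exact hFS x hx
    · rw [Measure.map_apply hXSm measurableSet_Iic]
      exact hFSneg x hx
  have hM : ∀ x : ℝ, 0 ≤ x →
      μ.map XM (Iic x) = ENNReal.ofReal (1 - Real.exp (-(lamM * π * x ^ 2))) := by
    intro x hx
    rw [Measure.map_apply hXMm measurableSet_Iic]
    exact hFM x hx
  have hMpos : ∀ᵐ y ∂μ.map XM, 0 < y := by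
    have h : μ.map XM (Iic 0) = 0 := by simp [hM 0 le_rfl]
    filter_upwards [measure_eq_zero_iff_ae_notMem.mp h] with y hy
    simpa using hy
  let E : Set (ℝ × ℝ) := {z | B * z.2 ^ (-αM) < z.1 ^ (-αS) ∧ z.1 ^ (-αS) < A * z.2 ^ (-αM)}
  have hE : MeasurableSet E := by
    refine MeasurableSet.inter (s₁ := {z : ℝ × ℝ | B * z.2 ^ (-αM) < z.1 ^ (-αS)})
      (s₂ := {z : ℝ × ℝ | z.1 ^ (-αS) < A * z.2 ^ (-αM)}) ?_ ?_ <;>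
    exact measurableSet_lt (by fun_prop) (by fun_prop)
  have hsection : ∀ x : ℝ, 0 < x → μ.map XM (Prod.mk x ⁻¹' E) =
      ENNReal.ofReal (Real.exp (-(lamM * π * B ^ (2 / αM) * x ^ (2 * αS / αM)))
        - Real.exp (-(lamM * π * A ^ (2 / αM) * x ^ (2 * αS / αM)))) := by
    intro x hx
    have h : Prod.mk x ⁻¹' E =ᵐ[μ.map XM]
        Ioo (B ^ (1 / αM) * x ^ (αS / αM)) (A ^ (1 / αM) * x ^ (αS / αM)) := by
      filter_upwards [hMpos] with y hy
      exact propext (and_congr (mul_rpow_neg_lt_rpow_neg_iff hB hx hy hαM)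
        (rpow_neg_lt_mul_rpow_neg_iff hA hx hy hαM))
    rw [measure_congr h, measure_Ioo_of_measure_Iic_eq_exp_sq hc hM (by positivity)
      (by positivity), sq_rpow_mul_rpow hB hx, sq_rpow_mul_rpow hA hx, ← mul_assoc, ← mul_assoc]
  have hprod : μ {ω | B * XM ω ^ (-αM) < XS ω ^ (-αS) ∧ XS ω ^ (-αS) < A * XM ω ^ (-αM)}
      = ((μ.map XS).prod (μ.map XM)) E := by
    rw [← (indepFun_iff_map_prod_eq_prod_map_map hXSm.aemeasurable hXMm.aemeasurable).mp hindep,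
      Measure.map_apply (hXSm.prodMk hXMm) hE]
    rfl
  have hdens : expMeasure (2 * lamS) = volume.withDensity (exponentialPDF (2 * lamS)) := rfl
  have hpdfm : Measurable (exponentialPDF (2 * lamS)) :=
    (measurable_exponentialPDFReal _).ennreal_ofReal
  let f : ℝ → ℝ → ℝ := fun K x ↦
    2 * lamS * Real.exp (-(lamM * π * K ^ (2 / αM) * x ^ (2 * αS / αM)) - 2 * lamS * x)
  have hf : ∀ K : ℝ, 0 < K → IntegrableOn (f K) (Ioi 0) := fun K hK ↦
    integrableOn_exp_neg_rpow_sub hc.le hr hK _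
  change _ = ENNReal.ofReal ((∫ x in Ioi 0, f B x) - ∫ x in Ioi 0, f A x)
  rw [hprod, Measure.prod_apply hE, hS, hdens,
    lintegral_withDensity_eq_lintegral_mul _ hpdfm (measurable_measure_prodMk_left hE),
    ← integral_sub' (hf B hB) (hf A hA),
    ofReal_integral_eq_lintegral_ofReal ((hf B hB).sub (hf A hA)),
    ← lintegral_indicator measurableSet_Ioi]
  · refine lintegral_congr_ae ?_
    filter_upwards [Measure.ae_ne volume (0 : ℝ)] with x hx0
    rcases lt_or_gt_of_ne hx0 with hx | hx
    · simp [exponentialPDF_of_neg hx, hx.le]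
    · rw [indicator_of_mem (mem_Ioi.mpr hx), Pi.mul_apply, hsection x hx,
        exponentialPDF_of_nonneg hx.le, ← ENNReal.ofReal_mul (by positivity)]
      simp only [f, Pi.sub_apply, sub_eq_add_neg _ (2 * lamS * x), Real.exp_add]
      congr 1
      ring
  · filter_upwards [ae_restrict_mem measurableSet_Ioi] with x hx
    have hx : 0 < x := hx
    simp only [f, Pi.zero_apply, Pi.sub_apply, sub_nonneg]
    gcongr
end

section
/- Let X_S and X_M be independent random variables with CDFs F_S(x) = 1 - exp(-2λ_S x) and F_M(x) = 1 - exp(-λ_M π x²) for x ≥ 0, where λ_S, λ_M > 0, let α > 0, and let 0 < B < A. When α_S = α_M = α, the probability of Case 2 has the closed form ℙ(B^{1/α} X_S < X_M < A^{1/α} X_S) = g(B) - g(A), where g(C) = sqrt(λ_S²/(λ_M C^{2/α})) · exp(λ_S²/(λ_M π C^{2/α})) · erfc(λ_S/sqrt(λ_M π C^{2/α})). -/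
open MeasureTheory ProbabilityTheory Real Set

/-- A real random variable with exponential distribution function has the exponential law. -/
lemma map_eq_expMeasure_of_cdf {Ω : Type*} [MeasurableSpace Ω] {μ : Measure Ω}
    [IsProbabilityMeasure μ] {X : Ω → ℝ} (hX : Measurable X) {r : ℝ} (hr : 0 < r)
    (hF : ∀ x : ℝ, 0 ≤ x → μ {ω | X ω ≤ x} = ENNReal.ofReal (1 - Real.exp (-(r * x))))
    (hFneg : ∀ x : ℝ, x < 0 → μ {ω | X ω ≤ x} = 0) :
    μ.map X = expMeasure r := by
  have := isProbabilityMeasure_expMeasure hr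
  have := Measure.isProbabilityMeasure_map (μ := μ) hX.aemeasurable
  refine Measure.eq_of_cdf _ _ (StieltjesFunction.ext fun x => ?_)
  rw [cdf_expMeasure_eq hr, cdf_eq_real, measureReal_def, Measure.map_apply hX measurableSet_Iic]
  change (μ {ω | X ω ≤ x}).toReal = _
  split_ifs with hx
  · rw [hF x hx, ENNReal.toReal_ofReal]
    rw [sub_nonneg, Real.exp_le_one_iff, neg_nonpos]
    positivity
  · rw [hFneg x (not_le.1 hx), ENNReal.toReal_zero]

/-- The probability of an open interval under a Rayleigh distribution function. -/
lemma map_Ioo_of_rayleigh_cdf {Ω : Type*} [MeasurableSpace Ω] {μ : Measure Ω}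
    [IsProbabilityMeasure μ] {X : Ω → ℝ} (hX : Measurable X) {k : ℝ} (hk : 0 < k)
    (hF : ∀ x : ℝ, 0 ≤ x → μ {ω | X ω ≤ x} = ENNReal.ofReal (1 - Real.exp (-(k * x ^ 2))))
    (hFneg : ∀ x : ℝ, x < 0 → μ {ω | X ω ≤ x} = 0) {u v : ℝ} (hu : 0 ≤ u) (hv : 0 ≤ v) :
    μ.map X (Ioo u v) =
      ENNReal.ofReal (Real.exp (-(k * u ^ 2)) - Real.exp (-(k * v ^ 2))) := by
  have := Measure.isProbabilityMeasure_map (μ := μ) hX.aemeasurable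
  have hcdf : ∀ x, cdf (μ.map X) x = 1 - Real.exp (-(k * max x 0 ^ 2)) := by
    intro x
    rw [cdf_eq_real, measureReal_def, Measure.map_apply hX measurableSet_Iic]
    change (μ {ω | X ω ≤ x}).toReal = _
    rcases le_or_gt 0 x with hx | hx
    · rw [hF x hx, ENNReal.toReal_ofReal, max_eq_left hx]
      rw [sub_nonneg, Real.exp_le_one_iff, neg_nonpos]
      positivity
    · simp [hFneg x hx, max_eq_right hx.le]
  have hcont : Continuous (cdf (μ.map X)) := by
    rw [funext hcdf]
    fun_prop
  rw [← measure_cdf (μ.map X), StieltjesFunction.measure_Ioo,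
    (hcont.continuousAt.continuousWithinAt).leftLim_eq, hcdf, hcdf, max_eq_left hu,
    max_eq_left hv]
  congr 1
  ring

lemma lintegral_expMeasure (r : ℝ) {f : ℝ → ENNReal} (hf : Measurable f) :
    ∫⁻ x, f x ∂(expMeasure r) =
      ∫⁻ x in Ioi 0, ENNReal.ofReal (r * Real.exp (-(r * x))) * f x := by
  change ∫⁻ x, f x ∂(volume.withDensity fun x => ENNReal.ofReal (exponentialPDFReal r x)) = _
  rw [lintegral_withDensity_eq_lintegral_mul _ (measurable_exponentialPDFReal r).ennreal_ofReal hf,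
    ← setLIntegral_congr Ioi_ae_eq_Ici.symm, ← lintegral_indicator measurableSet_Ici]
  refine lintegral_congr fun x => ?_
  by_cases hx : 0 ≤ x
  · have h := exponentialPDF_of_nonneg (r := r) hx
    rw [exponentialPDF] at h
    simp [hx, h]
  · have h := exponentialPDF_of_neg (r := r) (not_le.1 hx)
    rw [exponentialPDF] at h
    simp [hx, h]

lemma integrable_exp_density_mul_gaussian {r k : ℝ} (hr : 0 < r) (hk : 0 < k) :
    IntegrableOn (fun x => r * Real.exp (-(r * x)) * Real.exp (-(k * x ^ 2))) (Ioi 0) := by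
  refine Integrable.mono' ((integrable_exp_neg_mul_sq hk).const_mul r).integrableOn
    (by fun_prop) ?_
  filter_upwards [ae_restrict_mem measurableSet_Ioi] with x hx
  have hx : 0 < x := hx
  rw [Real.norm_of_nonneg (by positivity), neg_mul]
  gcongr
  have : Real.exp (-(r * x)) ≤ 1 := by
    rw [Real.exp_le_one_iff, neg_nonpos]
    positivity
  nlinarith

lemma integral_exp_density_mul_gaussian (l : ℝ) {k : ℝ} (hk : 0 < k) :
    ∫ x in Ioi 0, 2 * l * Real.exp (-(2 * l * x)) * Real.exp (-(k * x ^ 2)) =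
      l * (Real.sqrt π / Real.sqrt k) * Real.exp (l ^ 2 / k) * erfc (l / Real.sqrt k) := by
  have hs : 0 < Real.sqrt k := Real.sqrt_pos.2 hk
  have hsq : Real.sqrt k ^ 2 = k := Real.sq_sqrt hk.le
  have hpi : 0 < Real.sqrt π := Real.sqrt_pos.2 Real.pi_pos
  have hpt : ∀ x : ℝ, 2 * l * Real.exp (-(2 * l * x)) * Real.exp (-(k * x ^ 2)) =
      2 * l * Real.exp (l ^ 2 / k) *
        Real.exp (-(Real.sqrt k * x + l / Real.sqrt k) ^ 2) := by
    intro x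
    rw [mul_assoc, mul_assoc (2 * l), ← Real.exp_add, ← Real.exp_add]
    congr 2
    rw [← hsq, Real.sqrt_sq hs.le]
    field_simp
    ring
  have htrans := (measurePreserving_add_right volume (l / Real.sqrt k)).setIntegral_preimage_emb
    (measurableEmbedding_addRight _) (fun t => Real.exp (-t ^ 2)) (Ioi (l / Real.sqrt k))
  rw [preimage_add_const_Ioi, sub_self] at htrans
  simp_rw [hpt]
  rw [integral_const_mul,
    integral_comp_mul_left_Ioi (fun y => Real.exp (-(y + l / Real.sqrt k) ^ 2)) 0 hs, mul_zero,
    htrans, erfc, smul_eq_mul]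
  field_simp

theorem case2_association_probability_closed_form
    {Ω : Type*} [MeasurableSpace Ω] (μ : Measure Ω) [IsProbabilityMeasure μ]
    (XS XM : Ω → ℝ) (hXSm : Measurable XS) (hXMm : Measurable XM)
    (hindep : IndepFun XS XM μ)
    (lamS lamM α A B : ℝ)
    (hlamS : 0 < lamS) (hlamM : 0 < lamM)
    (hα : 0 < α) (hB : 0 < B) (hBA : B < A)
    (hFS : ∀ x : ℝ, 0 ≤ x →
      μ {ω | XS ω ≤ x} = ENNReal.ofReal (1 - Real.exp (-(2 * lamS * x))))
    (hFSneg : ∀ x : ℝ, x < 0 → μ {ω | XS ω ≤ x} = 0)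
    (hFM : ∀ x : ℝ, 0 ≤ x →
      μ {ω | XM ω ≤ x} = ENNReal.ofReal (1 - Real.exp (-(lamM * π * x ^ 2))))
    (hFMneg : ∀ x : ℝ, x < 0 → μ {ω | XM ω ≤ x} = 0)
    (g : ℝ → ℝ)
    (hg : ∀ C : ℝ, g C = Real.sqrt (lamS ^ 2 / (lamM * C ^ (2 / α)))
        * Real.exp (lamS ^ 2 / (lamM * π * C ^ (2 / α)))
        * erfc (lamS / Real.sqrt (lamM * π * C ^ (2 / α)))) :
    μ {ω | B ^ (1 / α) * XS ω < XM ω ∧ XM ω < A ^ (1 / α) * XS ω}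
      = ENNReal.ofReal (g B - g A) := by
  have hA : 0 < A := hB.trans hBA
  set b := B ^ (1 / α) with hb
  set a := A ^ (1 / α) with ha
  have hb0 : 0 < b := Real.rpow_pos_of_pos hB _
  have ha0 : 0 < a := Real.rpow_pos_of_pos hA _
  have hba : b < a := Real.rpow_lt_rpow hB.le hBA (by positivity)
  have hg' : ∀ C : ℝ, 0 < C → g C = ∫ x in Ioi 0, 2 * lamS * Real.exp (-(2 * lamS * x)) *
      Real.exp (-(lamM * π * (C ^ (1 / α)) ^ 2 * x ^ 2)) := by
    intro C hC
    have hsq : (C ^ (1 / α)) ^ 2 = C ^ (2 / α) := by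
      rw [← Real.rpow_natCast, ← Real.rpow_mul hC.le]
      congr 1
      push_cast
      ring
    have hC' : 0 < C ^ (2 / α) := Real.rpow_pos_of_pos hC _
    rw [hsq, integral_exp_density_mul_gaussian lamS (by positivity), hg]
    congr 2
    rw [Real.sqrt_div (sq_nonneg _), Real.sqrt_sq hlamS.le, mul_right_comm lamM π,
      Real.sqrt_mul (by positivity) π]
    have := Real.sqrt_pos.2 Real.pi_pos
    have : 0 < Real.sqrt (lamM * C ^ (2 / α)) := Real.sqrt_pos.2 (by positivity)
    field_simp
  have hmeas : MeasurableSet {p : ℝ × ℝ | b * p.1 < p.2 ∧ p.2 < a * p.1} :=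
    (measurableSet_lt (measurable_fst.const_mul b) measurable_snd).inter
      (measurableSet_lt measurable_snd (measurable_fst.const_mul a))
  have := Measure.isProbabilityMeasure_map (μ := μ) hXMm.aemeasurable
  have hsec : Measurable fun x => μ.map XM (Ioo (b * x) (a * x)) :=
    measurable_measure_prodMk_left hmeas
  have hlaw : μ {ω | b * XS ω < XM ω ∧ XM ω < a * XS ω} =
      ∫⁻ x, μ.map XM (Ioo (b * x) (a * x)) ∂(expMeasure (2 * lamS)) := by
    rw [← map_eq_expMeasure_of_cdf hXSm (by positivity) hFS hFSneg]
    have := Measure.isProbabilityMeasure_map (μ := μ) hXSm.aemeasurable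
    have hprod := Measure.prod_apply (μ := μ.map XS) (ν := μ.map XM) hmeas
    rw [← hindep.map_prod_eq_prod_map_map hXSm.aemeasurable hXMm.aemeasurable,
      Measure.map_apply (hXSm.prodMk hXMm) hmeas] at hprod
    exact hprod
  have hint : ∀ c : ℝ, 0 < c → IntegrableOn (fun x => 2 * lamS * Real.exp (-(2 * lamS * x)) *
      Real.exp (-(lamM * π * c ^ 2 * x ^ 2))) (Ioi 0) := fun c hc =>
    integrable_exp_density_mul_gaussian (by positivity) (by positivity)
  rw [hlaw, lintegral_expMeasure _ hsec, hg' B hB, hg' A hA, ← hb, ← ha,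
    ← integral_sub (hint b hb0) (hint a ha0)]
  refine Eq.trans ?_
    (ofReal_integral_eq_lintegral_ofReal ((hint b hb0).sub (hint a ha0)) ?_).symm
  · refine setLIntegral_congr_fun measurableSet_Ioi fun x hx => ?_
    have hx : 0 < x := hx
    change _ * μ.map XM (Ioo (b * x) (a * x)) = _
    rw [map_Ioo_of_rayleigh_cdf hXMm (by positivity) hFM hFMneg (by positivity) (by positivity),
      ← ENNReal.ofReal_mul (by positivity), mul_sub, mul_pow, mul_pow, ← mul_assoc, ← mul_assoc]
    rfl
  · filter_upwards [ae_restrict_mem measurableSet_Ioi] with x hx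
    have hx : 0 < x := hx
    change (0 : ℝ) ≤ _ - _
    rw [sub_nonneg]
    beta_reduce
    gcongr
end

section
/- Let X_S and X_M be independent random variables with CDFs F_S(x) = 1 - exp(-2λ_S x) and F_M(x) = 1 - exp(-λ_M π x²) for x ≥ 0, where λ_S, λ_M > 0, let α_S, α_M > 0 and B > 0, and suppose ℙ(Case 1) > 0 where Case 1 = {B·X_M^{-α_M} > X_S^{-α_S}}. Then for every x ≥ 0 the conditional distribution of the serving-MBS distance satisfies ℙ(X_M > x | Case 1) = (1/ℙ(Case 1)) · ∫_x^∞ exp(-2λ_S B^{-1/α_S} u^{α_M/α_S}) · 2π λ_M u · exp(-λ_M π u²) du. -/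
open MeasureTheory ProbabilityTheory Real Set

/-- The law of a nonnegative random variable with CDF `1 - exp (-(a x²))` has density
`2 a u exp (-(a u²))` on the positive half-line. -/
theorem eq_withDensity_of_rayleigh_cdf {ν : Measure ℝ} [IsFiniteMeasure ν] {a : ℝ} (ha : 0 < a)
    (hν : ∀ x : ℝ, 0 ≤ x → ν (Iic x) = ENNReal.ofReal (1 - Real.exp (-(a * x ^ 2))))
    (hneg : ∀ x : ℝ, x < 0 → ν (Iic x) = 0) :
    ν = (volume.restrict (Ioi 0)).withDensity
      (fun u => ENNReal.ofReal (2 * a * u * Real.exp (-(a * u ^ 2)))) := by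
  refine Measure.ext_of_Iic _ _ fun x => ?_
  rw [withDensity_apply _ measurableSet_Iic, Measure.restrict_restrict measurableSet_Iic,
    Iic_inter_Ioi]
  rcases lt_or_ge x 0 with hx | hx
  · rw [hneg x hx, Ioc_eq_empty (by simpa using hx.le)]
    simp
  · have hcont : Continuous fun u : ℝ => 2 * a * u * Real.exp (-(a * u ^ 2)) := by fun_prop
    have hderiv : ∀ u ∈ uIcc 0 x, HasDerivAt (fun u : ℝ => -Real.exp (-(a * u ^ 2)))
        (2 * a * u * Real.exp (-(a * u ^ 2))) u := by
      intro u _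
      have h := (((hasDerivAt_pow 2 u).const_mul a).neg.exp).neg
      refine h.congr_deriv ?_
      simp only [Pi.neg_apply]
      push_cast
      ring
    have hint := intervalIntegral.integral_eq_sub_of_hasDerivAt hderiv
      (hcont.intervalIntegrable 0 x)
    rw [intervalIntegral.integral_of_le hx] at hint
    rw [hν x hx, ← ofReal_integral_eq_lintegral_ofReal, hint]
    · congr 1
      simp
      ring
    · exact (hcont.integrableOn_Icc).mono_set Ioc_subset_Icc_self
    · filter_upwards [ae_restrict_mem measurableSet_Ioc] with u hu
      have := hu.1
      simp only [Pi.zero_apply]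
      positivity

/-- For positive distances, the biased power comparison is a threshold on the first distance. -/
theorem rpow_neg_lt_mul_rpow_neg_iff_s8 {s u α β B : ℝ} (hs : 0 < s) (hu : 0 < u) (hα : 0 < α)
    (hB : 0 < B) :
    s ^ (-α) < B * u ^ (-β) ↔ B ^ (-(1 / α)) * u ^ (β / α) < s := by
  have ht : 0 < B ^ (-(1 / α)) * u ^ (β / α) := by positivity
  have hpow : (B ^ (-(1 / α)) * u ^ (β / α)) ^ (-α) = B * u ^ (-β) := by
    rw [Real.mul_rpow (by positivity) (by positivity), ← Real.rpow_mul hB.le,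
      ← Real.rpow_mul hu.le]
    have h₁ : -(1 / α) * -α = 1 := by field_simp
    have h₂ : β / α * -α = -β := by field_simp
    rw [h₁, h₂, Real.rpow_one]
  rw [← hpow]
  exact Real.rpow_lt_rpow_iff_of_neg hs ht (neg_lt_zero.mpr hα)

/-- Exponential tail, restricted by the biased power comparison with a fixed distance `u`. -/
theorem measure_rpow_neg_lt_mul_rpow_neg {ν : Measure ℝ} [IsProbabilityMeasure ν]
    {r u α β B : ℝ} (hr : 0 < r) (hu : 0 < u) (hα : 0 < α) (hB : 0 < B)
    (hν : ∀ x : ℝ, 0 ≤ x → ν (Iic x) = ENNReal.ofReal (1 - Real.exp (-(r * x)))) :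
    ν {s | s ^ (-α) < B * u ^ (-β)}
      = ENNReal.ofReal (Real.exp (-(r * B ^ (-(1 / α)) * u ^ (β / α)))) := by
  have hnull : ∀ᵐ s ∂ν, 0 < s := by
    rw [ae_iff]
    simpa [← Iic_def] using hν 0 le_rfl
  have ht : 0 ≤ B ^ (-(1 / α)) * u ^ (β / α) := by positivity
  have hset : {s : ℝ | s ^ (-α) < B * u ^ (-β)} =ᵐ[ν] Ioi (B ^ (-(1 / α)) * u ^ (β / α)) := by
    filter_upwards [hnull] with s hs
    exact propext (rpow_neg_lt_mul_rpow_neg_iff_s8 hs hu hα hB)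
  have hexp : Real.exp (-(r * (B ^ (-(1 / α)) * u ^ (β / α)))) ≤ 1 :=
    Real.exp_le_one_iff.mpr (neg_nonpos.mpr (by positivity))
  rw [measure_congr hset, ← compl_Iic, prob_compl_eq_one_sub measurableSet_Iic, hν _ ht,
    ← ENNReal.ofReal_one, ← ENNReal.ofReal_sub _ (sub_nonneg.mpr hexp), sub_sub_cancel, mul_assoc]

theorem case1_serving_distance_distribution
    {Ω : Type*} [MeasurableSpace Ω] (μ : Measure Ω) [IsProbabilityMeasure μ]
    (XS XM : Ω → ℝ) (hXSm : Measurable XS) (hXMm : Measurable XM)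
    (hindep : IndepFun XS XM μ)
    (lamS lamM αS αM B : ℝ)
    (hlamS : 0 < lamS) (hlamM : 0 < lamM)
    (hαS : 0 < αS) (hαM : 0 < αM) (hB : 0 < B)
    (hFS : ∀ x : ℝ, 0 ≤ x →
      μ {ω | XS ω ≤ x} = ENNReal.ofReal (1 - Real.exp (-(2 * lamS * x))))
    (hFSneg : ∀ x : ℝ, x < 0 → μ {ω | XS ω ≤ x} = 0)
    (hFM : ∀ x : ℝ, 0 ≤ x →
      μ {ω | XM ω ≤ x} = ENNReal.ofReal (1 - Real.exp (-(lamM * π * x ^ 2))))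
    (hFMneg : ∀ x : ℝ, x < 0 → μ {ω | XM ω ≤ x} = 0)
    (hpos : 0 < μ {ω | XS ω ^ (-αS) < B * XM ω ^ (-αM)}) :
    ∀ x : ℝ, 0 ≤ x →
      μ[|{ω | XS ω ^ (-αS) < B * XM ω ^ (-αM)}] {ω | x < XM ω}
        = ENNReal.ofReal
            ((μ {ω | XS ω ^ (-αS) < B * XM ω ^ (-αM)}).toReal⁻¹
              * ∫ u in Set.Ioi x,
                  Real.exp (-(2 * lamS * B ^ (-(1 / αS)) * u ^ (αM / αS)))
                    * (2 * π * lamM * u * Real.exp (-(lamM * π * u ^ 2)))) := by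
  intro x hx
  set C : Set Ω := {ω | XS ω ^ (-αS) < B * XM ω ^ (-αM)}
  have hCm : MeasurableSet C := measurableSet_lt (by fun_prop) (by fun_prop)
  have : IsProbabilityMeasure (μ.map XS) := Measure.isProbabilityMeasure_map hXSm.aemeasurable
  have : IsProbabilityMeasure (μ.map XM) := Measure.isProbabilityMeasure_map hXMm.aemeasurable
  have hS : ∀ y : ℝ, 0 ≤ y →
      μ.map XS (Iic y) = ENNReal.ofReal (1 - Real.exp (-(2 * lamS * y))) := fun y hy => by
    rw [Measure.map_apply hXSm measurableSet_Iic]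
    exact hFS y hy
  have hM : μ.map XM = (volume.restrict (Ioi 0)).withDensity
      (fun u => ENNReal.ofReal (2 * (lamM * π) * u * Real.exp (-(lamM * π * u ^ 2)))) := by
    refine eq_withDensity_of_rayleigh_cdf (by positivity) (fun y hy => ?_) (fun y hy => ?_)
    · rw [Measure.map_apply hXMm measurableSet_Iic]
      exact hFM y hy
    · rw [Measure.map_apply hXMm measurableSet_Iic]
      exact hFMneg y hy
  let D : Set (ℝ × ℝ) := {p | p.2 ^ (-αS) < B * p.1 ^ (-αM)} ∩ {p | x < p.1}
  have hDm : MeasurableSet D :=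
    (measurableSet_lt (by fun_prop) (by fun_prop)).inter
      (measurableSet_lt (by fun_prop) (by fun_prop))
  have hjoint : μ (C ∩ {ω | x < XM ω}) = ((μ.map XM).prod (μ.map XS)) D := by
    rw [← (indepFun_iff_map_prod_eq_prod_map_map hXMm.aemeasurable hXSm.aemeasurable).mp
      hindep.symm, Measure.map_apply (hXMm.prodMk hXSm) hDm]
    rfl
  have hlint : μ (C ∩ {ω | x < XM ω}) = ∫⁻ u in Ioi x, ENNReal.ofReal
      (Real.exp (-(2 * lamS * B ^ (-(1 / αS)) * u ^ (αM / αS)))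
        * (2 * π * lamM * u * Real.exp (-(lamM * π * u ^ 2)))) := by
    rw [hjoint, Measure.prod_apply hDm, hM,
      lintegral_withDensity_eq_lintegral_mul _ (by fun_prop) (measurable_measure_prodMk_left hDm),
      ← inter_eq_left.mpr (Ioi_subset_Ioi hx), ← setLIntegral_indicator measurableSet_Ioi]
    refine setLIntegral_congr_fun measurableSet_Ioi fun u hu => ?_
    have hu : 0 < u := hu
    simp only [Pi.mul_apply]
    by_cases hxu : x < u
    · have hsec : Prod.mk u ⁻¹' D = {s | s ^ (-αS) < B * u ^ (-αM)} := by
        ext s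
        simp [D, hxu]
      rw [hsec, measure_rpow_neg_lt_mul_rpow_neg (by positivity) hu hαS hB hS,
        indicator_of_mem (mem_Ioi.mpr hxu), ← ENNReal.ofReal_mul (by positivity)]
      congr 1
      ring
    · have hsec : Prod.mk u ⁻¹' D = ∅ := by
        ext s
        simp [D, hxu]
      rw [hsec, indicator_of_notMem (by simpa using hxu)]
      simp
  have hint : ENNReal.ofReal (∫ u in Ioi x,
      Real.exp (-(2 * lamS * B ^ (-(1 / αS)) * u ^ (αM / αS)))
        * (2 * π * lamM * u * Real.exp (-(lamM * π * u ^ 2)))) = μ (C ∩ {ω | x < XM ω}) := by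
    rw [integral_eq_lintegral_of_nonneg_ae, ← hlint, ENNReal.ofReal_toReal (measure_ne_top _ _)]
    · filter_upwards [ae_restrict_mem measurableSet_Ioi] with u hu
      have hu : 0 < u := hx.trans_lt hu
      simp only [Pi.zero_apply]
      positivity
    · exact Measurable.aestronglyMeasurable (by fun_prop)
  rw [cond_apply hCm, ENNReal.ofReal_mul (by positivity), hint,
    ENNReal.ofReal_inv_of_pos (ENNReal.toReal_pos hpos.ne' (measure_ne_top _ _)),
    ENNReal.ofReal_toReal (measure_ne_top _ _)]
end

section
/- Let X_S and X_M be independent random variables with CDFs F_S(x) = 1 - exp(-2λ_S x) and F_M(x) = 1 - exp(-λ_M π x²) for x ≥ 0, where λ_S, λ_M > 0, let α_S, α_M > 0 and A > 0, and suppose ℙ(Case 4) > 0 where Case 4 = {A·X_M^{-α_M} < X_S^{-α_S}}. Then for every x ≥ 0 the conditional distribution of the serving-SBS distance satisfies ℙ(X_S > x | Case 4) = (1/ℙ(Case 4)) · ∫_x^∞ exp(-λ_M π A^{2/α_M} u^{2α_S/α_M}) · 2λ_S exp(-2λ_S u) du. -/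
open MeasureTheory ProbabilityTheory Real Set

lemma mul_rpow_neg_lt_rpow_neg_iff_s11 {A a b m u : ℝ} (hA : 0 < A) (hb : 0 < b)
    (hm : 0 < m) (hu : 0 < u) :
    A * m ^ (-b) < u ^ (-a) ↔ A ^ (1 / b) * u ^ (a / b) < m := by
  have ht : 0 < A ^ (1 / b) * u ^ (a / b) := by positivity
  have hpow : (A ^ (1 / b) * u ^ (a / b)) ^ (-b) = A⁻¹ * u ^ (-a) := by
    rw [mul_rpow (by positivity) (by positivity), ← rpow_mul hA.le, ← rpow_mul hu.le,
      ← rpow_neg_one A]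
    congr 2 <;> field_simp
  rw [← rpow_lt_rpow_iff_of_neg hm ht (neg_lt_zero.mpr hb), hpow, lt_inv_mul_iff₀ hA]

lemma eq_expMeasure_of_Iic {ν : Measure ℝ} [IsProbabilityMeasure ν] {r : ℝ} (hr : 0 < r)
    (hnonneg : ∀ x, 0 ≤ x → ν (Iic x) = ENNReal.ofReal (1 - Real.exp (-(r * x))))
    (hneg : ∀ x, x < 0 → ν (Iic x) = 0) : ν = expMeasure r := by
  have := isProbabilityMeasure_expMeasure hr
  refine Measure.ext_of_Iic _ _ fun x ↦ ?_
  rw [← ofReal_cdf (expMeasure r), cdf_expMeasure_eq hr]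
  split_ifs with h
  · exact hnonneg x h
  · simpa using hneg x (not_le.mp h)

lemma measure_Ioi_of_Iic_eq_one_sub {ν : Measure ℝ} [IsProbabilityMeasure ν] {t p : ℝ}
    (hp : p ≤ 1) (h : ν (Iic t) = ENNReal.ofReal (1 - p)) :
    ν (Ioi t) = ENNReal.ofReal p := by
  rw [← compl_Iic, prob_compl_eq_one_sub measurableSet_Iic, h, ← ENNReal.ofReal_one,
    ← ENNReal.ofReal_sub _ (by linarith)]
  congr 1
  ring

theorem case4_serving_SBS_distance_distribution
    {Ω : Type*} [MeasurableSpace Ω] (μ : Measure Ω) [IsProbabilityMeasure μ]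
    (XS XM : Ω → ℝ) (hXSm : Measurable XS) (hXMm : Measurable XM)
    (hindep : IndepFun XS XM μ)
    (lamS lamM αS αM A : ℝ)
    (hlamS : 0 < lamS) (hlamM : 0 < lamM)
    (hαS : 0 < αS) (hαM : 0 < αM) (hA : 0 < A)
    (hFS : ∀ x : ℝ, 0 ≤ x →
      μ {ω | XS ω ≤ x} = ENNReal.ofReal (1 - Real.exp (-(2 * lamS * x))))
    (hFSneg : ∀ x : ℝ, x < 0 → μ {ω | XS ω ≤ x} = 0)
    (hFM : ∀ x : ℝ, 0 ≤ x →
      μ {ω | XM ω ≤ x} = ENNReal.ofReal (1 - Real.exp (-(lamM * π * x ^ 2))))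
    (hFMneg : ∀ x : ℝ, x < 0 → μ {ω | XM ω ≤ x} = 0)
    (hpos : 0 < μ {ω | A * XM ω ^ (-αM) < XS ω ^ (-αS)}) :
    ∀ x : ℝ, 0 ≤ x →
      μ[|{ω | A * XM ω ^ (-αM) < XS ω ^ (-αS)}] {ω | x < XS ω}
        = ENNReal.ofReal
            ((μ {ω | A * XM ω ^ (-αM) < XS ω ^ (-αS)}).toReal⁻¹
              * ∫ u in Set.Ioi x,
                  Real.exp (-(lamM * π * A ^ (2 / αM) * u ^ (2 * αS / αM)))
                    * (2 * lamS * Real.exp (-(2 * lamS * u)))) := by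
  intro x hx
  have hC : MeasurableSet {ω | A * XM ω ^ (-αM) < XS ω ^ (-αS)} :=
    measurableSet_lt (by fun_prop) (by fun_prop)
  have hνS : IsProbabilityMeasure (μ.map XS) :=
    Measure.isProbabilityMeasure_map hXSm.aemeasurable
  have hνM : IsProbabilityMeasure (μ.map XM) :=
    Measure.isProbabilityMeasure_map hXMm.aemeasurable
  have hS : μ.map XS = expMeasure (2 * lamS) := by
    refine eq_expMeasure_of_Iic (by positivity) (fun y hy ↦ ?_) fun y hy ↦ ?_
    · rw [Measure.map_apply hXSm measurableSet_Iic]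
      exact hFS y hy
    · rw [Measure.map_apply hXSm measurableSet_Iic]
      exact hFSneg y hy
  have hMtail (t : ℝ) (ht : 0 ≤ t) :
      μ.map XM (Ioi t) = ENNReal.ofReal (Real.exp (-(lamM * π * t ^ 2))) := by
    refine measure_Ioi_of_Iic_eq_one_sub
      (Real.exp_le_one_iff.mpr (neg_nonpos.mpr (by positivity))) ?_
    rw [Measure.map_apply hXMm measurableSet_Iic]
    exact hFM t ht
  have hMpos : ∀ᵐ m ∂(μ.map XM), 0 < m := by
    have h0 : μ.map XM (Iic 0) = 0 := by
      rw [Measure.map_apply hXMm measurableSet_Iic]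
      simpa [preimage, Iic] using hFM 0 le_rfl
    rw [ae_iff]
    simpa [Iic] using h0
  set g : ℝ → ℝ := fun u ↦ Real.exp (-(lamM * π * A ^ (2 / αM) * u ^ (2 * αS / αM))) with hg
  have hgm : Measurable g := by fun_prop
  have hsection (u : ℝ) (hu : 0 < u) :
      μ.map XM {m | A * m ^ (-αM) < u ^ (-αS)} = ENNReal.ofReal (g u) := by
    have hae : {m : ℝ | A * m ^ (-αM) < u ^ (-αS)} =ᵐ[μ.map XM]
        Ioi (A ^ (1 / αM) * u ^ (αS / αM)) := by
      filter_upwards [hMpos] with m hm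
      exact propext (mul_rpow_neg_lt_rpow_neg_iff_s11 hA hαM hm hu)
    rw [measure_congr hae, hMtail _ (by positivity), mul_pow, ← rpow_mul_natCast hA.le,
      ← rpow_mul_natCast hu.le]
    simp only [hg]
    congr 3
    rw [mul_assoc (lamM * π)]
    congr 3 <;> push_cast <;> ring_nf
  have hjoint : μ ({ω | A * XM ω ^ (-αM) < XS ω ^ (-αS)} ∩ {ω | x < XS ω}) =
      ∫⁻ u in Ioi x, ENNReal.ofReal (g u * (2 * lamS * Real.exp (-(2 * lamS * u)))) := by
    have hT : MeasurableSet {p : ℝ × ℝ | A * p.2 ^ (-αM) < p.1 ^ (-αS) ∧ x < p.1} :=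
      measurableSet_setOfPred.mpr <| .and
        (measurableSet_setOfPred.mp (measurableSet_lt (by fun_prop) (by fun_prop)))
        (measurableSet_setOfPred.mp (measurableSet_lt (by fun_prop) (by fun_prop)))
    have hmap : μ ({ω | A * XM ω ^ (-αM) < XS ω ^ (-αS)} ∩ {ω | x < XS ω}) =
        μ.map (fun ω ↦ (XS ω, XM ω))
          {p : ℝ × ℝ | A * p.2 ^ (-αM) < p.1 ^ (-αS) ∧ x < p.1} := by
      rw [Measure.map_apply (by fun_prop) hT]
      rfl
    have hslice (u : ℝ) : μ.map XM (Prod.mk u ⁻¹'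
        {p : ℝ × ℝ | A * p.2 ^ (-αM) < p.1 ^ (-αS) ∧ x < p.1}) =
        (Ioi x).indicator (fun u ↦ ENNReal.ofReal (g u)) u := by
      by_cases hu : x < u
      · simpa [hu] using hsection u (hx.trans_lt hu)
      · simp [hu]
    rw [hmap, hindep.map_prod_eq_prod_map_map hXSm.aemeasurable hXMm.aemeasurable,
      Measure.prod_apply hT, lintegral_congr hslice, lintegral_indicator measurableSet_Ioi, hS]
    have hpdf : Measurable (exponentialPDF (2 * lamS)) :=
      (measurable_exponentialPDFReal _).ennreal_ofReal
    have hdens : expMeasure (2 * lamS) = volume.withDensity (exponentialPDF (2 * lamS)) := rfl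
    rw [hdens, setLIntegral_withDensity_eq_setLIntegral_mul _ hpdf
      hgm.ennreal_ofReal measurableSet_Ioi]
    refine setLIntegral_congr_fun measurableSet_Ioi fun u hu ↦ ?_
    simp only [Pi.mul_apply]
    rw [exponentialPDF_of_nonneg (hx.trans (le_of_lt hu)), mul_comm,
      ENNReal.ofReal_mul (Real.exp_nonneg _)]
  have hfin : μ ({ω | A * XM ω ^ (-αM) < XS ω ^ (-αS)} ∩ {ω | x < XS ω}) ≠ ⊤ :=
    measure_ne_top _ _
  have hint : ENNReal.ofReal (∫ u in Ioi x, g u * (2 * lamS * Real.exp (-(2 * lamS * u)))) =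
      μ ({ω | A * XM ω ^ (-αM) < XS ω ^ (-αS)} ∩ {ω | x < XS ω}) := by
    rw [integral_eq_lintegral_of_nonneg_ae (ae_of_all _ fun u ↦ by positivity)
      (by fun_prop), ← hjoint, ENNReal.ofReal_toReal hfin]
  rw [cond_apply hC, ENNReal.ofReal_mul (by positivity), hint,
    ENNReal.ofReal_inv_of_pos (ENNReal.toReal_pos hpos.ne' (measure_ne_top _ _)),
    ENNReal.ofReal_toReal (measure_ne_top _ _)]
end

section
/- Let X_S and X_M be independent random variables with CDFs F_S(x) = 1 - exp(-2λ_S x) and F_M(x) = 1 - exp(-λ_M π x²) for x ≥ 0, where λ_S, λ_M > 0, let α_S, α_M > 0 and A > 0, and suppose ℙ(M) > 0 where M = {A·X_M^{-α_M} > X_S^{-α_S}} is the coupled-access MBS association event. Then for every x ≥ 0, ℙ(X_M > x | M) = (1/ℙ(M)) · ∫_x^∞ exp(-2λ_S A^{-1/α_S} u^{α_M/α_S}) · 2π λ_M u · exp(-λ_M π u²) du. -/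
open MeasureTheory ProbabilityTheory Real Set

lemma ae_pos_of_measure_le_zero {Ω : Type*} [MeasurableSpace Ω] {μ : Measure Ω} {X : Ω → ℝ}
    (hX : Measurable X) (h0 : μ {ω | X ω ≤ 0} = 0) : ∀ᵐ s ∂(μ.map X), 0 < s := by
  rw [ae_map_iff hX.aemeasurable measurableSet_Ioi, ae_iff]
  simpa using h0

/-- A random variable with the Rayleigh-type distribution function `1 - exp (-c x²)` has density
`2 c u exp (-c u²)` on the positive half-line. -/
lemma map_eq_withDensity_of_cdf {Ω : Type*} [MeasurableSpace Ω] {μ : Measure Ω}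
    [IsProbabilityMeasure μ] {X : Ω → ℝ} (hX : Measurable X) {c : ℝ} (hc : 0 < c)
    (hF : ∀ x : ℝ, 0 ≤ x → μ {ω | X ω ≤ x} = ENNReal.ofReal (1 - Real.exp (-(c * x ^ 2))))
    (hFneg : ∀ x : ℝ, x < 0 → μ {ω | X ω ≤ x} = 0) :
    μ.map X = (volume.restrict (Ioi 0)).withDensity
      fun u => ENNReal.ofReal (2 * c * u * Real.exp (-(c * u ^ 2))) := by
  have : IsProbabilityMeasure (μ.map X) := Measure.isProbabilityMeasure_map hX.aemeasurable
  refine Measure.ext_of_Iic _ _ fun x => ?_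
  rw [Measure.map_apply hX measurableSet_Iic, withDensity_apply _ measurableSet_Iic,
    Measure.restrict_restrict measurableSet_Iic, Iic_inter_Ioi]
  change μ {ω | X ω ≤ x} = _
  rcases lt_or_ge x 0 with hx | hx
  · rw [hFneg x hx, Ioc_eq_empty (not_lt.2 hx.le)]
    simp
  · have hcont : Continuous fun u : ℝ => 2 * c * u * Real.exp (-(c * u ^ 2)) := by fun_prop
    have hderiv : ∀ u : ℝ, HasDerivAt (fun u => -Real.exp (-(c * u ^ 2)))
        (2 * c * u * Real.exp (-(c * u ^ 2))) u := fun u => by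
      refine HasDerivAt.congr_deriv ((hasDerivAt_pow 2 u).const_mul c).neg.exp.neg ?_
      simp only [Pi.neg_apply, Nat.cast_ofNat, Nat.add_one_sub_one, pow_one]
      ring
    rw [hF x hx, ← ofReal_integral_eq_lintegral_ofReal
      hcont.integrableOn_Ioc,
      ← intervalIntegral.integral_of_le hx,
      intervalIntegral.integral_eq_sub_of_hasDerivAt (fun u _ => hderiv u)
        (hcont.intervalIntegrable _ _)]
    · simp
      ring_nf
    · filter_upwards [ae_restrict_mem measurableSet_Ioc] with u hu
      have := hu.1
      simp only [Pi.zero_apply]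
      positivity

lemma rpow_neg_lt_mul_rpow_neg_iff_s13 {s m a b A : ℝ} (hs : 0 < s) (hm : 0 < m) (ha : 0 < a)
    (hA : 0 < A) : s ^ (-a) < A * m ^ (-b) ↔ A ^ (-(1 / a)) * m ^ (b / a) < s := by
  have h : A * m ^ (-b) = (A ^ (-(1 / a)) * m ^ (b / a)) ^ (-a) := by
    rw [mul_rpow (by positivity) (by positivity), ← rpow_mul hA.le, ← rpow_mul hm.le]
    congr 1
    · rw [show -(1 / a) * -a = 1 by field_simp, rpow_one]
    · congr 1
      field_simp
  rw [h]
  exact rpow_lt_rpow_iff_of_neg hs (by positivity) (neg_lt_zero.2 ha)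

theorem coupled_MBS_serving_distance_distribution
    {Ω : Type*} [MeasurableSpace Ω] (μ : Measure Ω) [IsProbabilityMeasure μ]
    (XS XM : Ω → ℝ) (hXSm : Measurable XS) (hXMm : Measurable XM)
    (hindep : IndepFun XS XM μ)
    (lamS lamM αS αM A : ℝ)
    (hlamS : 0 < lamS) (hlamM : 0 < lamM)
    (hαS : 0 < αS) (hαM : 0 < αM) (hA : 0 < A)
    (hFS : ∀ x : ℝ, 0 ≤ x →
      μ {ω | XS ω ≤ x} = ENNReal.ofReal (1 - Real.exp (-(2 * lamS * x))))
    (hFSneg : ∀ x : ℝ, x < 0 → μ {ω | XS ω ≤ x} = 0)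
    (hFM : ∀ x : ℝ, 0 ≤ x →
      μ {ω | XM ω ≤ x} = ENNReal.ofReal (1 - Real.exp (-(lamM * π * x ^ 2))))
    (hFMneg : ∀ x : ℝ, x < 0 → μ {ω | XM ω ≤ x} = 0)
    (hpos : 0 < μ {ω | XS ω ^ (-αS) < A * XM ω ^ (-αM)}) :
    ∀ x : ℝ, 0 ≤ x →
      μ[|{ω | XS ω ^ (-αS) < A * XM ω ^ (-αM)}] {ω | x < XM ω}
        = ENNReal.ofReal
            ((μ {ω | XS ω ^ (-αS) < A * XM ω ^ (-αM)}).toReal⁻¹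
              * ∫ u in Set.Ioi x,
                  Real.exp (-(2 * lamS * A ^ (-(1 / αS)) * u ^ (αM / αS)))
                    * (2 * π * lamM * u * Real.exp (-(lamM * π * u ^ 2)))) := by
  intro x hx
  have hS0 := ae_pos_of_measure_le_zero hXSm (by simpa using hFS 0 le_rfl)
  have hdens := map_eq_withDensity_of_cdf hXMm (mul_pos hlamM pi_pos) hFM hFMneg
  have : IsProbabilityMeasure (μ.map XS) := Measure.isProbabilityMeasure_map hXSm.aemeasurable
  have : IsProbabilityMeasure (μ.map XM) := Measure.isProbabilityMeasure_map hXMm.aemeasurable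
  have htail : ∀ t : ℝ, 0 ≤ t →
      μ.map XS (Ioi t) = ENNReal.ofReal (Real.exp (-(2 * lamS * t))) := fun t ht => by
    have h1 : Real.exp (-(2 * lamS * t)) ≤ 1 := exp_le_one_iff.2 (by
      have : 0 ≤ 2 * lamS * t := by positivity
      linarith)
    rw [← compl_Iic, prob_compl_eq_one_sub measurableSet_Iic,
      Measure.map_apply hXSm measurableSet_Iic]
    change 1 - μ {ω | XS ω ≤ t} = _
    rw [hFS t ht, ← ENNReal.ofReal_one, ← ENNReal.ofReal_sub _ (by linarith)]
    congr 1
    ring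
  have hMmeas : MeasurableSet {ω | XS ω ^ (-αS) < A * XM ω ^ (-αM)} :=
    measurableSet_lt (by fun_prop) (by fun_prop)
  have hEmeas : MeasurableSet {p : ℝ × ℝ | p.1 ^ (-αS) < A * p.2 ^ (-αM) ∧ x < p.2} :=
    MeasurableSet.inter (s₁ := {p : ℝ × ℝ | p.1 ^ (-αS) < A * p.2 ^ (-αM)})
      (s₂ := {p : ℝ × ℝ | x < p.2}) (measurableSet_lt (by fun_prop) (by fun_prop))
      (measurableSet_lt measurable_const measurable_snd)
  have hslice : ∀ m : ℝ, 0 < m →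
      μ.map XS ((fun s => (s, m)) ⁻¹'
        {p : ℝ × ℝ | p.1 ^ (-αS) < A * p.2 ^ (-αM) ∧ x < p.2})
      = (Ioi x).indicator (fun u => ENNReal.ofReal
          (Real.exp (-(2 * lamS * A ^ (-(1 / αS)) * u ^ (αM / αS))))) m := fun m hm => by
    by_cases hxm : x < m
    · rw [indicator_of_mem (mem_Ioi.2 hxm), mul_assoc (2 * lamS),
        ← htail _ (by positivity)]
      refine measure_congr ?_
      filter_upwards [hS0] with s hs
      refine propext ?_
      change (s ^ (-αS) < A * m ^ (-αM) ∧ x < m) ↔ _ < s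
      rw [rpow_neg_lt_mul_rpow_neg_iff_s13 hs hm hαS hA]
      exact and_iff_left hxm
    · rw [indicator_of_notMem (by simpa using hxm)]
      simp [hxm]
  have hjoint : μ ({ω | XS ω ^ (-αS) < A * XM ω ^ (-αM)} ∩ {ω | x < XM ω})
      = ∫⁻ u in Ioi x, ENNReal.ofReal
          (Real.exp (-(2 * lamS * A ^ (-(1 / αS)) * u ^ (αM / αS)))
            * (2 * π * lamM * u * Real.exp (-(lamM * π * u ^ 2)))) := by
    change μ ((fun ω => (XS ω, XM ω)) ⁻¹'
      {p : ℝ × ℝ | p.1 ^ (-αS) < A * p.2 ^ (-αM) ∧ x < p.2}) = _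
    rw [← Measure.map_apply (hXSm.prodMk hXMm) hEmeas,
      (indepFun_iff_map_prod_eq_prod_map_map hXSm.aemeasurable hXMm.aemeasurable).1 hindep,
      Measure.prod_apply_symm hEmeas, hdens,
      lintegral_withDensity_eq_lintegral_mul _ (by fun_prop) (measurable_measure_prodMk_right hEmeas)]
    rw [← inter_eq_self_of_subset_left (Ioi_subset_Ioi hx),
      ← Measure.restrict_restrict measurableSet_Ioi, ← lintegral_indicator (s := Ioi x) measurableSet_Ioi]
    refine setLIntegral_congr_fun measurableSet_Ioi fun m hm => ?_
    simp only [Pi.mul_apply, hslice m hm]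
    by_cases hxm : m ∈ Ioi x
    · rw [indicator_of_mem hxm, indicator_of_mem hxm, mul_comm,
        ← ENNReal.ofReal_mul (exp_pos _).le]
      congr 2
      ring
    · simp [indicator_of_notMem hxm]
  rw [cond_apply hMmeas, hjoint, ENNReal.ofReal_mul (by positivity),
    ENNReal.ofReal_inv_of_pos (ENNReal.toReal_pos hpos.ne' (measure_ne_top _ _)),
    ENNReal.ofReal_toReal (measure_ne_top _ _), ofReal_integral_eq_lintegral_ofReal]
  · refine ⟨Measurable.aestronglyMeasurable (by fun_prop), ?_⟩
    rw [hasFiniteIntegral_iff_ofReal, ← hjoint]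
    · exact measure_lt_top _ _
    · filter_upwards [ae_restrict_mem measurableSet_Ioi] with u hu
      have : 0 < u := hx.trans_lt hu
      simp only [Pi.zero_apply]
      positivity
  · filter_upwards [ae_restrict_mem measurableSet_Ioi] with u hu
    have : 0 < u := hx.trans_lt hu
    simp only [Pi.zero_apply]
    positivity
end
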